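/- Von Neumann lemma: There exists a constant C > 0 such that the following holds. Let W ⊆ 𝔽₂ⁿ be a linear subspace and let X, Y, D ⊆ W be nonempty subsets of sizes |X| = δ_X·|W|, |Y| = δ_Y·|W|, |D| = δ_D·|W|. Let A ⊆ S(X, Y, D) be a nonempty subset of size |A| = α·δ_X·δ_Y·δ_D·|W|². Let ε ∈ (0, 1/10) and let p be a positive integer with p ≥ C·ε^{-4}·log(2/(α·δ_D)). Define F₁ : Y × D → {0,1} by F₁(y, z) = 1_A(y+z, y) and F₂ : X × D → {0,1} by F₂(x, z) = 1_A(x, x+z). Suppose: (1) E_{y₁,y₂∈Y, z₁,…,z_p∈D}[∏_{i∈[2], j∈[p]} F₁(y_i, z_j)] < ((1+ε²/36)·α·δ_X)^{2p}; (2) E_{x₁,x₂∈X, z₁,…,z_p∈D}[∏_{i∈[2], j∈[p]} F₂(x_i, z_j)] < (2·α·δ_Y)^{2p}; and (3) for every y ∈ Y, E_{x∈W}[1_A(x, y)] ≥ (1−ε²/36)·α·δ_X·δ_D. Then E_{x,y,z∈W}[1_A(x, y)·1_A(y+z, y)·1_A(x, x+z)] ≥ (1−4ε)·α³·δ_X²·δ_Y²·δ_D².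 -/

import Mathlib

open scoped Classical

/-- The container set `S(X, Y, D)` (Section 5.1 of the paper). -/
def Container (n : ℕ) (X Y D : Set (Fin n → ZMod 2)) :
    Set ((Fin n → ZMod 2) × (Fin n → ZMod 2)) :=
  {p | p.1 ∈ X ∧ p.2 ∈ Y ∧ p.1 + p.2 ∈ D}

theorem vn_expand {X Y D : Type*} [Fintype X] [Fintype Y] [Fintype D]
    (G : Y → D → ℝ) (H : X → D → ℝ) (k : ℕ) :
    ∑ x, ∑ y, (∑ z, G y z * H x z) ^ k
      = ∑ z : Fin k → D, (∑ y, ∏ j, G y (z j)) * (∑ x, ∏ j, H x (z j)) := by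
  simp_rw [Fintype.sum_pow, Finset.prod_mul_distrib, Finset.sum_mul_sum]
  rw [Finset.sum_comm]
  simp_rw [Finset.sum_comm (s := (Finset.univ : Finset X))]
  rw [Finset.sum_comm]

theorem vn_cs {X Y D : Type*} [Fintype X] [Fintype Y] [Fintype D]
    (G : Y → D → ℝ) (H : X → D → ℝ) (k : ℕ) :
    (∑ x, ∑ y, (∑ z, G y z * H x z) ^ k) ^ 2
      ≤ (∑ y₁, ∑ y₂, (∑ z, G y₁ z * G y₂ z) ^ k) * (∑ x₁, ∑ x₂, (∑ z, H x₁ z * H x₂ z) ^ k) := by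
  have h1 := vn_expand G G k
  have h2 := vn_expand H H k
  have e1 : ∑ y₁, ∑ y₂, (∑ z, G y₁ z * G y₂ z) ^ k = ∑ z : Fin k → D, (∑ y, ∏ j, G y (z j)) ^ 2 := by
    rw [Finset.sum_comm, h1]; simp_rw [sq]
  have e2 : ∑ y₁, ∑ y₂, (∑ z, H y₁ z * H y₂ z) ^ k = ∑ z : Fin k → D, (∑ y, ∏ j, H y (z j)) ^ 2 := by
    rw [Finset.sum_comm, h2]; simp_rw [sq]
  rw [e1, e2, vn_expand]
  exact Finset.sum_mul_sq_le_sq_mul_sq _ _ _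

theorem vn_nonneg {Y D : Type*} [Fintype Y] [Fintype D] (G : Y → D → ℝ) (k : ℕ) :
    0 ≤ ∑ y₁, ∑ y₂, (∑ z, G y₁ z * G y₂ z) ^ k := by
  rw [Finset.sum_comm, vn_expand]
  exact Finset.sum_nonneg fun z _ => mul_self_nonneg _

theorem vn_grid {Y D : Type*} [Fintype Y] [Fintype D] (G : Y → D → ℝ) (k : ℕ) :
    ∑ y : Fin 2 → Y, ∑ z : Fin k → D, ∏ i : Fin 2, ∏ j : Fin k, G (y i) (z j)
     = ∑ y₁, ∑ y₂, (∑ z, G y₁ z * G y₂ z) ^ k := by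
  simp_rw [Fintype.sum_pow, Fin.prod_univ_two, Finset.prod_mul_distrib]
  refine (Fintype.sum_equiv (finTwoArrowEquiv Y) _
    (fun y : Y × Y => ∑ z : Fin k → D, (∏ j, G y.1 (z j)) * ∏ j, G y.2 (z j)) (fun y => rfl)).trans ?_
  rw [Fintype.sum_prod_type]

theorem vn_point (u v η t : ℝ) (k p q : ℕ) (hη : 0 < η) (hη1 : η < 1/3600) (ht : t = 36 * η)
    (hk : Even k) (hq : 3 ≤ q * t) (hp : q * (k+1) ≤ p) (hv : 0 ≤ v) (huv : u + 1 - 2 * η ≤ v) :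
    ((1+η)^2)^p * ((2*u/t)^k / 2 - 3/2 + (2*u/t)^(k+1) / 2) ≤ v ^ p := by
  have ht0 : 0 < t := by linarith
  obtain ⟨w, hw⟩ : ∃ w, w = 2*u/t := ⟨_, rfl⟩
  have hu : u = w * (t/2) := by rw [hw]; field_simp
  rw [← hw]
  have hR : 0 < ((1+η)^2)^p := by positivity
  rcases le_or_gt w 1 with h1 | h1
  · have : w^k / 2 - 3/2 + w^(k+1)/2 ≤ 0 := by
      rcases le_or_gt (-1) w with h2 | h2
      · have h3 : |w| ≤ 1 := abs_le.2 ⟨h2, h1⟩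
        have h4 : w^k ≤ 1 := (le_abs_self _).trans (by rw [abs_pow]; exact pow_le_one₀ (abs_nonneg _) h3)
        have h5 : w^(k+1) ≤ 1 := (le_abs_self _).trans (by rw [abs_pow]; exact pow_le_one₀ (abs_nonneg _) h3)
        linarith
      · have : 0 ≤ w^k := hk.pow_nonneg _
        rw [pow_succ]; nlinarith
    calc _ ≤ 0 := mul_nonpos_of_nonneg_of_nonpos hR.le this
      _ ≤ _ := by positivity
  · have hs : (1+η)^2 * (1 + (w-1)*(t/3)) ≤ v := by
      refine le_trans ?_ huv
      rw [hu, ht]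
      nlinarith [mul_pos hη (sub_pos.2 h1), mul_pos hη hη, mul_pos (mul_pos hη hη) (sub_pos.2 h1)]
    have hw0 : 0 ≤ (w-1)*(t/3) := by have := sub_pos.2 h1; positivity
    have hb : w ≤ (1 + (w-1)*(t/3))^q := by
      have := one_add_mul_le_pow (a := (w-1)*(t/3)) (by linarith) q
      nlinarith
    have hb2 : w^(k+1) ≤ (1 + (w-1)*(t/3))^p := by
      calc w^(k+1) ≤ ((1 + (w-1)*(t/3))^q)^(k+1) := by gcongr
        _ = (1 + (w-1)*(t/3))^(q*(k+1)) := by rw [pow_mul]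
        _ ≤ _ := pow_le_pow_right₀ (by linarith) hp
    have hkk : w^k ≤ w^(k+1) := pow_le_pow_right₀ h1.le (by omega)
    calc _ ≤ ((1+η)^2)^p * (1 + (w-1)*(t/3))^p := by gcongr; linarith
      _ = ((1+η)^2 * (1 + (w-1)*(t/3)))^p := by rw [mul_pow]
      _ ≤ _ := by gcongr

theorem vn_moment {ι : Type*} [Fintype ι] (u v : ι → ℝ) (η t : ℝ) (k p q : ℕ) (hη : 0 < η) (hη1 : η < 1/3600)
    (ht : t = 36 * η)
    (hk : Even k) (hk4 : 4 ≤ k) (hq : 3 ≤ q * t) (hp : q * (k+1) ≤ p) (hv : ∀ i, 0 ≤ v i)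
    (huv : ∀ i, u i + 1 - 2 * η ≤ v i) (hodd : 0 ≤ ∑ i, u i ^ (k+1))
    (hsum : ∑ i, v i ^ p ≤ Fintype.card ι * ((1+η)^2)^p) :
    ∑ i, u i ^ k ≤ Fintype.card ι * t ^ k := by
  have ht0 : 0 < t := by linarith
  have h := Finset.sum_le_sum (s := Finset.univ) fun i _ =>
    vn_point (u i) (v i) η t k p q hη hη1 ht hk hq hp (hv i) (huv i)
  rw [← Finset.mul_sum] at h
  have hR : 0 < ((1+η)^2)^p := by positivity
  have h2 := h.trans hsum
  rw [mul_comm] at h2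
  have h3 := le_of_mul_le_mul_right h2 hR
  rw [Finset.sum_add_distrib, Finset.sum_sub_distrib, ← Finset.sum_div, ← Finset.sum_div, ← Finset.sum_div] at h3
  simp only [Finset.sum_const, Finset.card_univ, nsmul_eq_mul] at h3
  have e : ∀ j, ∑ i, (2 * u i / t)^j = (2/t)^j * ∑ i, u i ^ j := by
    intro j; rw [Finset.mul_sum]; refine Finset.sum_congr rfl fun i _ => ?_
    rw [← mul_pow]; congr 1; ring
  rw [e, e] at h3
  have h4 : 0 ≤ (2/t)^(k+1) * ∑ i, u i ^ (k+1) := by positivity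
  have h5 : (2/t)^k * ∑ i, u i ^ k ≤ 5 * Fintype.card ι := by linarith
  have h6 : (5:ℝ) ≤ 2^k := le_trans (by norm_num) (pow_le_pow_right₀ (by norm_num) hk4 : (2:ℝ)^4 ≤ 2^k)
  have h7 : (2/t)^k * ∑ i, u i ^ k ≤ (2/t)^k * (Fintype.card ι * t^k) := by
    have : (2/t)^k * (Fintype.card ι * t^k) = 2^k * Fintype.card ι := by
      rw [div_pow]; field_simp
    rw [this]; refine h5.trans ?_; gcongr
  exact le_of_mul_le_mul_left h7 (by positivity)

theorem vn_boundG {Y D : Type*} [Fintype Y] [Fintype D] [Nonempty D] (F : Y → D → ℝ) (d₁ ε : ℝ) (k p q : ℕ)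
    (hd : 0 < d₁) (hF : ∀ y z, 0 ≤ F y z) (hε : 0 < ε) (hε1 : ε < 1/10) (hk : Even k) (hk4 : 4 ≤ k)
    (hq : 3 ≤ q * ε^2) (hp : q * (k+1) ≤ p)
    (hdeg : ∀ y, (1 - ε^2/36) * d₁ * Fintype.card D ≤ ∑ z, F y z)
    (h1 : ∑ y₁, ∑ y₂, (∑ z, F y₁ z * F y₂ z) ^ p
      ≤ (Fintype.card Y : ℝ)^2 * (Fintype.card D : ℝ)^p * ((1+ε^2/36) * d₁)^(2*p)) :
    ∑ y₁, ∑ y₂, (∑ z, (F y₁ z - d₁) * (F y₂ z - d₁)) ^ k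
      ≤ (Fintype.card Y : ℝ)^2 * (ε^2 * d₁^2 * Fintype.card D)^k := by
  have hD : (0:ℝ) < Fintype.card D := by exact_mod_cast Fintype.card_pos
  obtain ⟨d, hdd⟩ : ∃ d : ℝ, d = Fintype.card D := ⟨_, rfl⟩
  rw [← hdd] at hdeg h1 hD ⊢
  have key := vn_moment (ι := Y × Y) (fun y => (∑ z, (F y.1 z - d₁) * (F y.2 z - d₁)) / (d₁^2 * d))
    (fun y => (∑ z, F y.1 z * F y.2 z) / (d₁^2 * d)) (ε^2/36) (ε^2) k p q (by positivity) (by nlinarith)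
    (by ring) hk hk4 hq hp
    (fun y => div_nonneg (Finset.sum_nonneg fun z _ => mul_nonneg (hF _ _) (hF _ _)) (by positivity))
    (by
      intro y
      have e : ∑ z, (F y.1 z - d₁) * (F y.2 z - d₁)
          = ∑ z, F y.1 z * F y.2 z - d₁ * (∑ z, F y.1 z) - d₁ * (∑ z, F y.2 z) + d₁^2 * d := by
        rw [hdd, Finset.mul_sum, Finset.mul_sum, ← Finset.sum_sub_distrib, ← Finset.sum_sub_distrib,
          mul_comm (d₁^2), ← nsmul_eq_mul, ← Finset.card_univ, ← Finset.sum_const, ← Finset.sum_add_distrib]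
        exact Finset.sum_congr rfl fun z _ => by ring
      simp only [e]
      rw [le_div_iff₀ (by positivity)]
      have := mul_le_mul_of_nonneg_left (hdeg y.1) hd.le
      have := mul_le_mul_of_nonneg_left (hdeg y.2) hd.le
      have e2 : ∀ a : ℝ, (a / (d₁^2*d) + 1 - 2 * (ε^2/36)) * (d₁^2*d) = a + (1 - 2 * (ε^2/36)) * (d₁^2*d) := by
        intro a; field_simp; ring
      rw [e2]
      nlinarith)
    (by
      simp_rw [div_pow]
      rw [← Finset.sum_div, Fintype.sum_prod_type]
      exact div_nonneg (vn_nonneg (fun y z => F y z - d₁) (k+1)) (by positivity))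
    (by
      simp_rw [div_pow]
      rw [← Finset.sum_div, Fintype.sum_prod_type, div_le_iff₀ (by positivity)]
      refine h1.trans (le_of_eq ?_)
      rw [Fintype.card_prod]; push_cast
      rw [pow_mul, mul_pow, mul_pow, mul_pow]; ring)
  simp_rw [div_pow] at key
  rw [← Finset.sum_div, Fintype.sum_prod_type, div_le_iff₀ (by positivity), Fintype.card_prod] at key
  refine key.trans (le_of_eq ?_)
  push_cast
  rw [mul_pow, mul_pow, mul_pow]; ring

theorem vn_boundH {X D : Type*} [Fintype X] [Fintype D] [Nonempty D] (F : X → D → ℝ) (c : ℝ) (k p : ℕ)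
    (hc : 0 < c) (hF : ∀ y z, 0 ≤ F y z) (hp : k ≤ p)
    (h1 : ∑ y₁, ∑ y₂, (∑ z, F y₁ z * F y₂ z) ^ p
      ≤ (Fintype.card X : ℝ)^2 * (Fintype.card D : ℝ)^p * c^(2*p)) :
    ∑ y₁, ∑ y₂, (∑ z, F y₁ z * F y₂ z) ^ k
      ≤ 2 * (Fintype.card X : ℝ)^2 * (c^2 * Fintype.card D)^k := by
  have hD : (0:ℝ) < Fintype.card D := by exact_mod_cast Fintype.card_pos
  obtain ⟨d, hdd⟩ : ∃ d : ℝ, d = Fintype.card D := ⟨_, rfl⟩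
  rw [← hdd] at h1 hD ⊢
  have hpt : ∀ w : ℝ, 0 ≤ w → w^k ≤ w^p / (c^2*d)^p * (c^2*d)^k + (c^2*d)^k := by
    intro w hw
    obtain ⟨r, hr⟩ : ∃ r, r = w / (c^2*d) := ⟨_, rfl⟩
    have hr0 : 0 ≤ r := by rw [hr]; positivity
    have hwr : w = r * (c^2*d) := by rw [hr]; field_simp
    rw [← div_pow, ← hr, hwr, mul_pow]
    have : r^k ≤ r^p + 1 := by
      rcases le_total r 1 with h | h
      · have := pow_le_one₀ hr0 h (n := k); have := pow_nonneg hr0 p; linarith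
      · have := pow_le_pow_right₀ h hp; linarith
    have h3 : 0 < (c^2*d)^k := by positivity
    nlinarith
  calc ∑ y₁, ∑ y₂, (∑ z, F y₁ z * F y₂ z) ^ k
      ≤ ∑ y₁, ∑ y₂, ((∑ z, F y₁ z * F y₂ z)^p / (c^2*d)^p * (c^2*d)^k + (c^2*d)^k) := by
        gcongr with y₁ _ y₂ _
        exact hpt _ (Finset.sum_nonneg fun z _ => mul_nonneg (hF _ _) (hF _ _))
    _ = (∑ y₁, ∑ y₂, (∑ z, F y₁ z * F y₂ z)^p) / (c^2*d)^p * (c^2*d)^k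
          + (Fintype.card X : ℝ)^2 * (c^2*d)^k := by
        simp_rw [Finset.sum_add_distrib, Finset.sum_div, Finset.sum_mul]
        simp; ring
    _ ≤ ((Fintype.card X : ℝ)^2 * d^p * c^(2*p)) / (c^2*d)^p * (c^2*d)^k
          + (Fintype.card X : ℝ)^2 * (c^2*d)^k := by gcongr
    _ = _ := by
        rw [mul_pow (c^2) d p, pow_mul]; field_simp; ring

theorem vn_core {X Y D : Type*} [Fintype X] [Fintype Y] [Fintype D] [Nonempty X] [Nonempty Y] [Nonempty D]
    (F₁ : Y → D → ℝ) (F₂ : X → D → ℝ) (S : Finset (X × Y)) (d₁ d₂ σ ε : ℝ) (k p q : ℕ)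
    (hd : 0 < d₁) (hd2 : 0 < d₂) (hσ : 0 < σ) (hF : ∀ y z, 0 ≤ F₁ y z) (hF2 : ∀ y z, 0 ≤ F₂ y z)
    (hε : 0 < ε) (hε1 : ε < 1/10) (hk : Even k) (hk4 : 4 ≤ k)
    (hq : 3 ≤ q * ε^2) (hp : q * (k+1) ≤ p) (hkσ : 2 / σ ≤ 2^k)
    (hS : (S.card : ℝ) = σ * Fintype.card X * Fintype.card Y)
    (hS2 : (S.card : ℝ) = d₂ * Fintype.card X * Fintype.card D)
    (hr : ∀ x, ∑ z, F₂ x z = ((S.filter (fun s => s.1 = x)).card : ℝ))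
    (hdeg : ∀ y, (1 - ε^2/36) * d₁ * Fintype.card D ≤ ∑ z, F₁ y z)
    (h1 : ∑ y₁, ∑ y₂, (∑ z, F₁ y₁ z * F₁ y₂ z) ^ p
      ≤ (Fintype.card Y : ℝ)^2 * (Fintype.card D : ℝ)^p * ((1+ε^2/36) * d₁)^(2*p))
    (h2 : ∑ y₁, ∑ y₂, (∑ z, F₂ y₁ z * F₂ y₂ z) ^ p
      ≤ (Fintype.card X : ℝ)^2 * (Fintype.card D : ℝ)^p * (2 * d₂)^(2*p)) :
    (1 - 4*ε) * d₁ * d₂ * Fintype.card D * S.card ≤ ∑ s ∈ S, ∑ z, F₁ s.2 z * F₂ s.1 z := by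
  have hG := vn_boundG F₁ d₁ ε k p q hd hF hε hε1 hk hk4 hq hp hdeg h1
  have hq1 : 1 ≤ q := by
    rcases Nat.eq_zero_or_pos q with h | h
    · subst h; norm_num at hq
    · exact h
  have hkp : k ≤ p := by nlinarith
  have hH := vn_boundH F₂ (2*d₂) k p (by positivity) hF2 hkp h2
  have hcs := vn_cs (fun y z => F₁ y z - d₁) F₂ k
  have hD : (0:ℝ) < Fintype.card D := by exact_mod_cast Fintype.card_pos
  have hX : (0:ℝ) < Fintype.card X := by exact_mod_cast Fintype.card_pos
  have hY : (0:ℝ) < Fintype.card Y := by exact_mod_cast Fintype.card_pos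
  obtain ⟨d, hdd⟩ : ∃ d : ℝ, d = Fintype.card D := ⟨_, rfl⟩
  obtain ⟨a, ha⟩ : ∃ d : ℝ, d = Fintype.card X := ⟨_, rfl⟩
  obtain ⟨b, hb⟩ : ∃ d : ℝ, d = Fintype.card Y := ⟨_, rfl⟩
  obtain ⟨m, hm⟩ : ∃ d : ℝ, d = S.card := ⟨_, rfl⟩
  rw [← hdd, ← hm]
  rw [← hdd] at hG hH hS2 hD
  rw [← ha] at hH hS hS2 hX
  rw [← hb] at hG hS hY
  rw [← hm] at hS hS2
  have hm0 : 0 < m := by rw [hS]; positivity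
  -- moment bound for h
  have hmom : ∑ x, ∑ y, (∑ z, (F₁ y z - d₁) * F₂ x z)^k ≤ 2 * a * b * (2*ε*d₁*d₂*d)^k := by
    refine le_of_sq_le_sq ?_ (by positivity)
    have hGn := vn_nonneg (fun y z => F₁ y z - d₁) k
    calc _ ≤ _ := hcs
      _ ≤ (b^2 * (ε^2*d₁^2*d)^k) * (2 * a^2 * ((2*d₂)^2*d)^k) := by
        apply mul_le_mul hG hH (vn_nonneg F₂ k) (by positivity)
      _ = 2 * (a*b)^2 * ((2*ε*d₁*d₂*d)^k)^2 := by
        have : ((2*ε*d₁*d₂*d)^k)^2 = (ε^2*d₁^2*d)^k * ((2*d₂)^2*d)^k := by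
          rw [← mul_pow, ← pow_mul, mul_comm k 2, pow_mul]; congr 1; ring
        rw [this]; ring
      _ ≤ 4 * (a*b)^2 * ((2*ε*d₁*d₂*d)^k)^2 := by gcongr; norm_num
      _ = _ := by ring
  -- Hölder
  have hhol : (∑ s ∈ S, (∑ z, (F₁ s.2 z - d₁) * F₂ s.1 z))^k ≤ (m * (4*ε*d₁*d₂*d))^k := by
    have hj := Real.pow_arith_mean_le_arith_mean_pow_of_even S (fun _ => 1/m)
      (fun s => ∑ z, (F₁ s.2 z - d₁) * F₂ s.1 z) (fun _ _ => by positivity)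
      (by rw [Finset.sum_const, nsmul_eq_mul, ← hm]; field_simp) hk
    rw [← Finset.mul_sum, ← Finset.mul_sum] at hj
    have hle : ∑ s ∈ S, (∑ z, (F₁ s.2 z - d₁) * F₂ s.1 z)^k ≤ 2 * a * b * (2*ε*d₁*d₂*d)^k := by
      refine le_trans ?_ hmom
      rw [← Fintype.sum_prod_type']
      exact Finset.sum_le_sum_of_subset_of_nonneg (Finset.subset_univ S) fun _ _ _ => hk.pow_nonneg _
    calc (∑ s ∈ S, (∑ z, (F₁ s.2 z - d₁) * F₂ s.1 z))^k
        = m^k * (1/m * ∑ s ∈ S, (∑ z, (F₁ s.2 z - d₁) * F₂ s.1 z))^k := by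
          rw [← mul_pow]; congr 1; field_simp
      _ ≤ m^k * (1/m * ∑ s ∈ S, (∑ z, (F₁ s.2 z - d₁) * F₂ s.1 z)^k) := by gcongr
      _ ≤ m^k * (1/m * (2 * a * b * (2*ε*d₁*d₂*d)^k)) := by gcongr
      _ = m^k * ((2/σ) * (2*ε*d₁*d₂*d)^k) := by
          congr 1; rw [hS]; field_simp
      _ ≤ m^k * (2^k * (2*ε*d₁*d₂*d)^k) := by gcongr
      _ = _ := by rw [← mul_pow, ← mul_pow]; congr 1; ring
  have habs : |∑ s ∈ S, (∑ z, (F₁ s.2 z - d₁) * F₂ s.1 z)| ≤ m * (4*ε*d₁*d₂*d) := by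
    refine le_of_pow_le_pow_left₀ (n := k) (by omega) (by positivity) ?_
    rw [hk.pow_abs]; exact hhol
  have hsplit : ∑ s ∈ S, ∑ z, F₁ s.2 z * F₂ s.1 z
      = ∑ s ∈ S, (∑ z, (F₁ s.2 z - d₁) * F₂ s.1 z) + d₁ * ∑ s ∈ S, ∑ z, F₂ s.1 z := by
    simp_rw [Finset.mul_sum, ← Finset.sum_add_distrib]
    exact Finset.sum_congr rfl fun s _ => Finset.sum_congr rfl fun z _ => by ring
  have hfib : ∑ s ∈ S, ∑ z, F₂ s.1 z = ∑ x : X, (((S.filter (fun s => s.1 = x)).card : ℝ))^2 := by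
    rw [← Finset.sum_fiberwise S (fun s => s.1)]
    refine Finset.sum_congr rfl fun x _ => ?_
    rw [Finset.sum_congr rfl (g := fun _ => ((S.filter (fun s => s.1 = x)).card : ℝ))]
    · rw [Finset.sum_const, nsmul_eq_mul, sq]
    · intro s hs
      rw [(Finset.mem_filter.1 hs).2, hr]
  have hcard : ∑ x : X, ((S.filter (fun s => s.1 = x)).card : ℝ) = m := by
    rw [hm, Finset.card_eq_sum_card_fiberwise (f := fun s : X × Y => s.1) (t := Finset.univ) (by simp)]
    push_cast; rfl
  have hcs2 : m * (d₂ * d) ≤ ∑ x : X, (((S.filter (fun s => s.1 = x)).card : ℝ))^2 := by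
    have := sq_sum_le_card_mul_sum_sq (s := (Finset.univ : Finset X))
      (f := fun x => ((S.filter (fun s => s.1 = x)).card : ℝ))
    rw [hcard, Finset.card_univ, ← ha] at this
    refine le_of_mul_le_mul_left (le_trans (le_of_eq ?_) this) hX
    rw [sq]; nth_rewrite 3 [hS2]; ring
  rw [hsplit, hfib]
  have := (abs_le.1 habs).1
  nlinarith [mul_le_mul_of_nonneg_left hcs2 hd.le]

theorem vn_params (σ ε : ℝ) (p : ℕ) (hσ : 0 < σ) (hσ1 : σ ≤ 1) (hε : 0 < ε) (hε1 : ε < 1/10)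
    (hp : 100 * ε⁻¹^4 * Real.log (2/σ) ≤ p) :
    ∃ k q : ℕ, Even k ∧ 4 ≤ k ∧ 3 ≤ q * ε^2 ∧ q * (k+1) ≤ p ∧ 2/σ ≤ 2^k := by
  have h2 : (2:ℝ) ≤ 2/σ := by rw [le_div_iff₀ hσ]; linarith
  obtain ⟨L, hL⟩ : ∃ L, L = Real.log (2/σ) := ⟨_, rfl⟩
  have hlog2 := Real.log_two_gt_d9
  have hL2 : Real.log 2 ≤ L := by rw [hL]; exact Real.log_le_log (by norm_num) h2
  rw [← hL] at hp
  have hL0 : 0 < L := by linarith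
  have hceil := Nat.ceil_lt_add_one hL0.le
  have hceil' := Nat.le_ceil L
  have hpos : 1 ≤ ⌈L⌉₊ := Nat.one_le_ceil_iff.2 hL0
  have hε2 : 0 < ε^2 := by positivity
  have hq0 : (0:ℝ) ≤ 3/ε^2 := by positivity
  have hqc := Nat.ceil_lt_add_one hq0
  have hqc' := Nat.le_ceil (3/ε^2)
  refine ⟨2*⌈L⌉₊+2, ⌈3/ε^2⌉₊, ⟨⌈L⌉₊+1, by ring⟩, by omega, ?_, ?_, ?_⟩
  · rwa [div_le_iff₀ hε2] at hqc'
  · have hi : ε⁻¹^4 = (1/ε^2)*(1/ε^2) := by field_simp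
    have hi1 : 1 ≤ 1/ε^2 := by rw [le_div_iff₀ hε2]; nlinarith
    have e3 : 3/ε^2 = 3 * (1/ε^2) := by ring
    obtain ⟨r, hr⟩ : ∃ r, r = 1/ε^2 := ⟨_, rfl⟩
    rw [← hr] at hi hi1 e3
    have hA : (⌈3/ε^2⌉₊ : ℝ) ≤ 4 * r := by linarith
    have hB : (2*(⌈L⌉₊:ℝ)+2+1) ≤ 12 * L := by linarith
    have : ((⌈3/ε^2⌉₊ * (2*⌈L⌉₊+2+1) : ℕ) : ℝ) ≤ p := by
      push_cast
      calc _ ≤ (4*r) * (12*L) := by gcongr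
        _ ≤ 100 * (r*r) * L := by
          have : 0 < r * L := by positivity
          nlinarith
        _ ≤ p := by rw [← hi]; exact hp
    exact_mod_cast this
  · have : 2/σ = Real.exp L := by rw [hL, Real.exp_log (by positivity)]
    rw [this]
    have e : (2:ℝ)^(2*⌈L⌉₊+2) = Real.exp ((2*⌈L⌉₊+2 : ℕ) * Real.log 2) := by
      rw [Real.exp_nat_mul, Real.exp_log (by norm_num)]
    rw [e, Real.exp_le_exp]
    push_cast
    nlinarith

set_option maxHeartbeats 1000000

/-- Von Neumann lemma (Lemma 5.9 of the paper): if `A ⊆ S(X, Y, D)` has bounded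
grid norms and no sparse rows, then `A` contains roughly the expected number of
corners. -/
theorem von_neumann_lemma :
    ∃ C : ℝ, 0 < C ∧
      ∀ (n : ℕ) (W : Submodule (ZMod 2) (Fin n → ZMod 2))
        (X Y D : Set (Fin n → ZMod 2))
        (A : Set ((Fin n → ZMod 2) × (Fin n → ZMod 2)))
        (δX δY δD α ε : ℝ) (p : ℕ),
        X.Nonempty → Y.Nonempty → D.Nonempty → A.Nonempty →
        X ⊆ (W : Set (Fin n → ZMod 2)) → Y ⊆ (W : Set (Fin n → ZMod 2)) →
        D ⊆ (W : Set (Fin n → ZMod 2)) →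
        A ⊆ Container n X Y D →
        (Nat.card ↥X : ℝ) = δX * (Nat.card ↥W : ℝ) →
        (Nat.card ↥Y : ℝ) = δY * (Nat.card ↥W : ℝ) →
        (Nat.card ↥D : ℝ) = δD * (Nat.card ↥W : ℝ) →
        (Nat.card ↥A : ℝ) = α * δX * δY * δD * (Nat.card ↥W : ℝ) ^ 2 →
        ε ∈ Set.Ioo (0 : ℝ) (1 / 10) → 0 < p →
        C * ε⁻¹ ^ 4 * Real.log (2 / (α * δD)) ≤ (p : ℝ) →
        -- (1): the (2,p)-grid norm of F₁(y, z) = 1_A(y+z, y) is small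
        (∑ y : Fin 2 → ↥Y, ∑ z : Fin p → ↥D, ∏ i : Fin 2, ∏ j : Fin p,
            (if ((y i : Fin n → ZMod 2) + (z j : Fin n → ZMod 2),
                (y i : Fin n → ZMod 2)) ∈ A then (1 : ℝ) else 0)) /
            ((Nat.card ↥Y : ℝ) ^ 2 * (Nat.card ↥D : ℝ) ^ p) <
          ((1 + ε ^ 2 / 36) * α * δX) ^ (2 * p) →
        -- (2): the (2,p)-grid norm of F₂(x, z) = 1_A(x, x+z) is small
        (∑ x : Fin 2 → ↥X, ∑ z : Fin p → ↥D, ∏ i : Fin 2, ∏ j : Fin p,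
            (if ((x i : Fin n → ZMod 2),
                (x i : Fin n → ZMod 2) + (z j : Fin n → ZMod 2)) ∈ A then (1 : ℝ) else 0)) /
            ((Nat.card ↥X : ℝ) ^ 2 * (Nat.card ↥D : ℝ) ^ p) <
          (2 * α * δY) ^ (2 * p) →
        -- (3): no sparse rows
        (∀ y ∈ Y, (1 - ε ^ 2 / 36) * α * δX * δD ≤
          (Nat.card ↥{x : Fin n → ZMod 2 | x ∈ W ∧ (x, y) ∈ A} : ℝ) /
            (Nat.card ↥W : ℝ)) →
        (1 - 4 * ε) * α ^ 3 * δX ^ 2 * δY ^ 2 * δD ^ 2 ≤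
          (Nat.card ↥{t : (Fin n → ZMod 2) × (Fin n → ZMod 2) × (Fin n → ZMod 2) |
              t.1 ∈ W ∧ t.2.1 ∈ W ∧ t.2.2 ∈ W ∧ (t.1, t.2.1) ∈ A ∧
              (t.2.1 + t.2.2, t.2.1) ∈ A ∧ (t.1, t.1 + t.2.2) ∈ A} : ℝ) /
            (Nat.card ↥W : ℝ) ^ 3 := by
  refine ⟨100, by norm_num, ?_⟩
  intro n W X Y D A δX δY δD α ε p hXn hYn hDn hAn hXW hYW hDW hAS hX hY hD hA hε _ hp h1 h2 h3
  obtain ⟨hε0, hε1⟩ := hε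
  have := hXn.to_subtype
  have := hYn.to_subtype
  have := hDn.to_subtype
  have hself : ∀ v : Fin n → ZMod 2, v + v = 0 := fun v => by
    funext i; exact CharTwo.add_self_eq_zero (v i)
  have hcan : ∀ u v : Fin n → ZMod 2, u + (u + v) = v := fun u v => by
    rw [← add_assoc, hself, zero_add]
  obtain ⟨N, hN⟩ : ∃ N : ℝ, N = Nat.card ↥W := ⟨_, rfl⟩
  have hN0 : 0 < N := by rw [hN]; exact_mod_cast Nat.card_pos
  rw [← hN] at hX hY hD hA h3 ⊢
  have cX : (0:ℝ) < Nat.card X := by exact_mod_cast Nat.card_pos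
  have cY : (0:ℝ) < Nat.card Y := by exact_mod_cast Nat.card_pos
  have cD : (0:ℝ) < Nat.card D := by exact_mod_cast Nat.card_pos
  have := hAn.to_subtype
  have cA : (0:ℝ) < Nat.card A := by exact_mod_cast Nat.card_pos
  have hδX : 0 < δX := by rw [hX] at cX; exact pos_of_mul_pos_left cX hN0.le
  have hδY : 0 < δY := by rw [hY] at cY; exact pos_of_mul_pos_left cY hN0.le
  have hδD : 0 < δD := by rw [hD] at cD; exact pos_of_mul_pos_left cD hN0.le
  have hα : 0 < α := by
    rw [hA] at cA
    by_contra h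
    push Not at h
    have : α * (δX * δY * δD * N^2) ≤ 0 := mul_nonpos_of_nonpos_of_nonneg h (by positivity)
    linarith
  let S : Finset (X × Y) := Finset.univ.filter fun s => ((s.1 : Fin n → ZMod 2), (s.2 : Fin n → ZMod 2)) ∈ A
  have hScard : (S.card : ℝ) = Nat.card A := by
    norm_cast
    rw [Nat.card_eq_fintype_card, ← Finset.card_univ]
    refine Finset.card_bij' (fun s hs => (⟨(s.1, s.2), (Finset.mem_filter.1 hs).2⟩ : A))
      (fun a _ => (⟨a.1.1, (hAS a.2).1⟩, ⟨a.1.2, (hAS a.2).2.1⟩)) ?_ ?_ ?_ ?_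
    · simp
    · intro a _; simp [S]
    · intro a _; rfl
    · intro a _; rfl
  have hSle : (S.card : ℝ) ≤ Nat.card X * Nat.card Y := by
    have := Finset.card_le_univ S
    rw [Fintype.card_prod, ← Nat.card_eq_fintype_card, ← Nat.card_eq_fintype_card] at this
    exact_mod_cast this
  have hσ1 : α * δD ≤ 1 := by
    rw [hScard, hA, hX, hY] at hSle
    have : 0 < δX * δY * N^2 := by positivity
    refine le_of_mul_le_mul_right ?_ this
    linarith
  obtain ⟨k, q, hk, hk4, hq, hqp, hkσ⟩ := vn_params (α*δD) ε p (by positivity) hσ1 hε0 hε1 hp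
  let F₁ : Y → D → ℝ := fun y z =>
    if ((y : Fin n → ZMod 2) + (z : Fin n → ZMod 2), (y : Fin n → ZMod 2)) ∈ A then (1 : ℝ) else 0
  let F₂ : X → D → ℝ := fun x z =>
    if ((x : Fin n → ZMod 2), (x : Fin n → ZMod 2) + (z : Fin n → ZMod 2)) ∈ A then (1 : ℝ) else 0
  have g1 := vn_grid F₁ p
  have g2 := vn_grid F₂ p
  have hr : ∀ x, ∑ z, F₂ x z = ((S.filter (fun s => s.1 = x)).card : ℝ) := by
    intro x
    simp only [F₂]
    rw [Finset.sum_boole]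
    norm_cast
    refine Finset.card_bij' (fun z hz => (x, ⟨x.1 + z.1, (hAS (Finset.mem_filter.1 hz).2).2.1⟩))
      (fun s hs => ⟨s.1.1 + s.2.1, (hAS (Finset.mem_filter.1 (Finset.mem_filter.1 hs).1).2).2.2⟩) ?_ ?_ ?_ ?_
    · intro z hz
      simpa [S] using hz
    · intro s hs
      obtain ⟨hs1, rfl⟩ := Finset.mem_filter.1 hs
      simpa [S, hcan] using hs1
    · intro z hz
      exact Subtype.ext (hcan _ _)
    · intro s hs
      obtain ⟨hs1, rfl⟩ := Finset.mem_filter.1 hs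
      exact Prod.ext rfl (Subtype.ext (hcan _ _))
  have core := vn_core F₁ F₂ S (α*δX) (α*δY) (α*δD) ε k p q (by positivity) (by positivity) (by positivity)
    (fun y z => by simp only [F₁]; split_ifs <;> norm_num)
    (fun y z => by simp only [F₂]; split_ifs <;> norm_num)
    hε0 hε1 hk hk4 hq hqp hkσ
    (by rw [← Nat.card_eq_fintype_card, ← Nat.card_eq_fintype_card, hScard, hA, hX, hY]; ring)
    (by rw [← Nat.card_eq_fintype_card, ← Nat.card_eq_fintype_card, hScard, hA, hX, hD]; ring)
    (by intro x; rw [hr x]; congr)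
    (by
      intro y
      have h := h3 y y.2
      rw [le_div_iff₀ hN0] at h
      rw [← Nat.card_eq_fintype_card, hD]
      refine le_trans (le_of_eq (by ring)) (h.trans (le_of_eq ?_))
      simp only [F₁]
      rw [Finset.sum_boole]
      norm_cast
      rw [Nat.card_eq_fintype_card, ← Finset.card_univ]
      refine Finset.card_bij' (fun x _ => ⟨y.1 + x.1, by
          have := (hAS x.2.2).2.2; rwa [add_comm] at this⟩)
        (fun z hz => ⟨y.1 + z.1, hXW (hAS (Finset.mem_filter.1 hz).2).1, (Finset.mem_filter.1 hz).2⟩) ?_ ?_ ?_ ?_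
      · intro x _
        simpa [hcan] using x.2.2
      · simp
      · intro x _; exact Subtype.ext (hcan _ _)
      · intro x _; exact Subtype.ext (hcan _ _))
    (by
      rw [← g1, ← Nat.card_eq_fintype_card, ← Nat.card_eq_fintype_card]
      rw [div_lt_iff₀ (by positivity)] at h1
      refine h1.le.trans (le_of_eq ?_)
      ring)
    (by
      rw [← g2, ← Nat.card_eq_fintype_card, ← Nat.card_eq_fintype_card]
      rw [div_lt_iff₀ (by positivity)] at h2
      refine h2.le.trans (le_of_eq ?_)
      ring)
  rw [le_div_iff₀ (by positivity)]
  rw [← Nat.card_eq_fintype_card, hScard, hA, hD] at core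
  refine le_trans (le_of_eq (by ring)) (core.trans ?_)
  have hT : ∑ s ∈ S, ∑ z, F₁ s.2 z * F₂ s.1 z
      = (((S ×ˢ (Finset.univ : Finset D)).filter fun t =>
        ((t.1.2 : Fin n → ZMod 2) + (t.2 : Fin n → ZMod 2), (t.1.2 : Fin n → ZMod 2)) ∈ A ∧
        ((t.1.1 : Fin n → ZMod 2), (t.1.1 : Fin n → ZMod 2) + (t.2 : Fin n → ZMod 2)) ∈ A).card : ℝ) := by
    rw [← Finset.sum_product', ← Finset.sum_boole]
    refine Finset.sum_congr rfl fun t _ => ?_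
    simp only [F₁, F₂]
    by_cases hc1 : ((t.1.2 : Fin n → ZMod 2) + (t.2 : Fin n → ZMod 2), (t.1.2 : Fin n → ZMod 2)) ∈ A
    · by_cases hc2 : ((t.1.1 : Fin n → ZMod 2), (t.1.1 : Fin n → ZMod 2) + (t.2 : Fin n → ZMod 2)) ∈ A
      · rw [if_pos hc1, if_pos hc2, if_pos ⟨hc1, hc2⟩, mul_one]
      · rw [if_neg hc2, mul_zero, if_neg (fun h => hc2 h.2)]
    · rw [if_neg hc1, zero_mul, if_neg (fun h => hc1 h.1)]
  rw [hT]
  norm_cast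
  rw [Nat.card_coe_set_eq, ← Set.ncard_coe_finset]
  refine Set.ncard_le_ncard_of_injOn
    (fun t => ((t.1.1 : Fin n → ZMod 2), (t.1.2 : Fin n → ZMod 2), (t.2 : Fin n → ZMod 2))) ?_ ?_ (Set.toFinite _)
  · intro t ht
    simp only [Finset.coe_filter, Finset.mem_product, Set.mem_setOf_eq, S, Finset.mem_filter,
      Finset.mem_univ, true_and, and_true] at ht
    exact ⟨hXW t.1.1.2, hYW t.1.2.2, hDW t.2.2, ht.1, ht.2.1, ht.2.2⟩
  · rintro ⟨⟨x, y⟩, z⟩ _ ⟨⟨x', y'⟩, z'⟩ _ h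
    simp only [Prod.mk.injEq] at h
    obtain ⟨ha, hb, hc⟩ := h
    rw [Subtype.ext ha, Subtype.ext hb, Subtype.ext hc]
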